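/- The alignment distance is well defined on the quotient by the orthogonal group action: for any two system descriptors Θ₁ and Θ₂ and any orthogonal n×n matrices R and S, d_O(R·Θ₁, S·Θ₂)² = d_O(Θ₁, Θ₂)². -/

import Mathlib

open Matrix

/-- A system descriptor `Θ = (A, C, μ)`: an `n×n` real matrix `A`, an `n`-tuple of
vectors `C` in a real inner product space `H`, and a bias `μ ∈ H`. -/
structure Descriptor (n : ℕ) (H : Type*) [NormedAddCommGroup H] [InnerProductSpace ℝ H] where
  A : Matrix (Fin n) (Fin n) ℝ
  C : Fin n → H
  μ : H

variable {n : ℕ} {H : Type*} [NormedAddCommGroup H] [InnerProductSpace ℝ H]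

/-- The action of an `n×n` matrix on a descriptor:
`Q·(A, C, μ) = (QᵀAQ, C·Q, μ)` where `(C·Q)(j) = Σ_i Q_{ij} C(i)`. -/
noncomputable def act (Q : Matrix (Fin n) (Fin n) ℝ) (Θ : Descriptor n H) : Descriptor n H where
  A := Qᵀ * Θ.A * Q
  C := fun j => ∑ i, Q i j • Θ.C i
  μ := Θ.μ

/-- The squared Frobenius distance
`d_F(Θ₁,Θ₂)² = λ_A‖A₁−A₂‖_F² + Σ_j ‖C₁(j)−C₂(j)‖² + λ_μ‖μ₁−μ₂‖²`. -/
noncomputable def dF2 (lamA lamMu : ℝ) (Θ₁ Θ₂ : Descriptor n H) : ℝ :=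
  lamA * Matrix.trace ((Θ₁.A - Θ₂.A)ᵀ * (Θ₁.A - Θ₂.A)) +
    ∑ j, ‖Θ₁.C j - Θ₂.C j‖ ^ 2 + lamMu * ‖Θ₁.μ - Θ₂.μ‖ ^ 2

/-- The alignment distance `d_O(Θ₁,Θ₂)² = inf_{Q ∈ O(n)} d_F(Θ₁, Q·Θ₂)²`. -/
noncomputable def dO2 (lamA lamMu : ℝ) (Θ₁ Θ₂ : Descriptor n H) : ℝ :=
  sInf {d : ℝ | ∃ Q : Matrix (Fin n) (Fin n) ℝ, Qᵀ * Q = 1 ∧ d = dF2 lamA lamMu Θ₁ (act Q Θ₂)}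

/-- The action is a right action of the multiplicative monoid of matrices. -/
theorem act_act (P Q : Matrix (Fin n) (Fin n) ℝ) (Θ : Descriptor n H) :
    act Q (act P Θ) = act (P * Q) Θ := by
  simp only [act, Descriptor.mk.injEq, and_true]
  refine ⟨by simp only [transpose_mul, Matrix.mul_assoc], ?_⟩
  funext j
  simp only [Finset.smul_sum, smul_smul, Matrix.mul_apply, Finset.sum_smul]
  rw [Finset.sum_comm]
  simp only [mul_comm]

/-- Orthogonal recombination of a tuple of vectors preserves the sum of squared norms. -/
theorem sum_norm_sq_sum_smul (R : Matrix (Fin n) (Fin n) ℝ) (hR : R * Rᵀ = 1) (v : Fin n → H) :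
    ∑ j, ‖∑ i, R i j • v i‖ ^ 2 = ∑ i, ‖v i‖ ^ 2 := by
  have hentry (i k : Fin n) : ∑ j, R i j * R k j = if i = k then 1 else 0 := by
    simpa [Matrix.mul_apply, Matrix.one_apply] using congrFun (congrFun hR i) k
  calc ∑ j, ‖∑ i, R i j • v i‖ ^ 2
      = ∑ j, ∑ i, ∑ k, R i j * R k j * inner ℝ (v i) (v k) := by
        simp only [← real_inner_self_eq_norm_sq, sum_inner, inner_sum, real_inner_smul_left,
          real_inner_smul_right, mul_assoc]
        simp only [real_inner_comm]
    _ = ∑ i, ∑ k, (∑ j, R i j * R k j) * inner ℝ (v i) (v k) := by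
        rw [Finset.sum_comm]
        refine Finset.sum_congr rfl fun i _ => ?_
        rw [Finset.sum_comm]
        simp only [Finset.sum_mul]
    _ = ∑ i, ‖v i‖ ^ 2 := by
        simp [hentry]

/-- The squared Frobenius distance is invariant under the simultaneous orthogonal action. -/
theorem dF2_act_act (lamA lamMu : ℝ) (R : Matrix (Fin n) (Fin n) ℝ) (hR : R * Rᵀ = 1)
    (Θ₁ Θ₂ : Descriptor n H) :
    dF2 lamA lamMu (act R Θ₁) (act R Θ₂) = dF2 lamA lamMu Θ₁ Θ₂ := by
  have hA : trace ((Rᵀ * Θ₁.A * R - Rᵀ * Θ₂.A * R)ᵀ * (Rᵀ * Θ₁.A * R - Rᵀ * Θ₂.A * R)) =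
      trace ((Θ₁.A - Θ₂.A)ᵀ * (Θ₁.A - Θ₂.A)) := by
    rw [← Matrix.sub_mul, ← Matrix.mul_sub]
    generalize Θ₁.A - Θ₂.A = D
    calc trace ((Rᵀ * D * R)ᵀ * (Rᵀ * D * R))
        = trace (Rᵀ * (Dᵀ * (R * Rᵀ) * D * R)) := by
          simp only [transpose_mul, transpose_transpose, Matrix.mul_assoc]
      _ = trace (Dᵀ * D) := by
          rw [Matrix.trace_mul_comm, hR, Matrix.mul_one, Matrix.mul_assoc, hR, Matrix.mul_one]
  have hC : ∑ j, ‖∑ i, R i j • Θ₁.C i - ∑ i, R i j • Θ₂.C i‖ ^ 2 =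
      ∑ j, ‖Θ₁.C j - Θ₂.C j‖ ^ 2 := by
    simpa only [smul_sub, Finset.sum_sub_distrib] using
      sum_norm_sq_sum_smul R hR fun i => Θ₁.C i - Θ₂.C i
  simp only [dF2, act, hA, hC]

/-- The alignment distance is well defined on the quotient by the `O(n)`-action:
`d_O(R·Θ₁, S·Θ₂)² = d_O(Θ₁, Θ₂)²` for orthogonal `R`, `S`. -/
theorem dO2_invariant (hn : 0 < n) (lamA lamMu : ℝ) (hlamA : 0 < lamA) (hlamMu : 0 < lamMu)
    (Θ₁ Θ₂ : Descriptor n H)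
    (R S : Matrix (Fin n) (Fin n) ℝ) (hR : Rᵀ * R = 1) (hS : Sᵀ * S = 1) :
    dO2 lamA lamMu (act R Θ₁) (act S Θ₂) = dO2 lamA lamMu Θ₁ Θ₂ := by
  have hR' : R * Rᵀ = 1 := mul_eq_one_comm.mp hR
  have hS' : S * Sᵀ = 1 := mul_eq_one_comm.mp hS
  unfold dO2
  congr 1
  ext d
  constructor
  · rintro ⟨Q, hQ, rfl⟩
    refine ⟨S * Q * Rᵀ, ?_, ?_⟩
    · calc (S * Q * Rᵀ)ᵀ * (S * Q * Rᵀ) = R * (Qᵀ * (Sᵀ * S) * Q) * Rᵀ := by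
            simp only [transpose_mul, transpose_transpose, Matrix.mul_assoc]
        _ = 1 := by rw [hS, Matrix.mul_one, hQ, Matrix.mul_one, hR']
    · rw [← dF2_act_act lamA lamMu R hR' Θ₁, act_act, act_act, Matrix.mul_assoc (S * Q), hR,
        Matrix.mul_one]
  · rintro ⟨Q, hQ, rfl⟩
    refine ⟨Sᵀ * Q * R, ?_, ?_⟩
    · calc (Sᵀ * Q * R)ᵀ * (Sᵀ * Q * R) = Rᵀ * (Qᵀ * (S * Sᵀ) * Q) * R := by
            simp only [transpose_mul, transpose_transpose, Matrix.mul_assoc]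
        _ = 1 := by rw [hS', Matrix.mul_one, hQ, Matrix.mul_one, hR]
    · rw [← dF2_act_act lamA lamMu R hR' Θ₁, act_act, act_act, ← Matrix.mul_assoc,
        ← Matrix.mul_assoc, hS', Matrix.one_mul]
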